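/- arXiv:0911.4520 — 3 statements merged into one kernel-verified Lean document; each statement's English description precedes it below -/
import Mathlib

section
/- Let g = (g_1, …, g_n) be i.i.d. standard Gaussian random variables and f : ℝⁿ → ℝ a C^∞ function with bounded derivatives of all orders. Then Var(f(g)) = Σ_{k=1}^∞ (1/k!) Σ_{1 ≤ i_1,…,i_k ≤ n} (E[∂^k f/∂g_{i_1}⋯∂g_{i_k}])², where the infinite series converges. -/
open MeasureTheory ProbabilityTheory

namespace HermiteAux
open Filter Topology Set

lemma mono_le {u u' : ℝ → ℝ} (hc : ContinuousOn u (Icc 0 1))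
    (hd : ∀ x ∈ Ioo (0:ℝ) 1, HasDerivAt u (u' x) x) (hn : ∀ x ∈ Ioo (0:ℝ) 1, 0 ≤ u' x)
    {x y : ℝ} (hx : 0 ≤ x) (hxy : x ≤ y) (hy : y ≤ 1) : u x ≤ u y := by
  have : MonotoneOn u (Icc 0 1) := by
    apply monotoneOn_of_deriv_nonneg (convex_Icc 0 1) hc
    · intro z hz
      rw [interior_Icc] at hz
      exact (hd z hz).differentiableAt.differentiableWithinAt
    · intro z hz
      rw [interior_Icc] at hz
      rw [(hd z hz).deriv]
      exact hn z hz
  exact this ⟨hx, hxy.trans hy⟩ ⟨hx.trans hxy, hy⟩ hxy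

/-- Taylor remainder. -/
noncomputable def rem (φ : ℕ → ℝ → ℝ) (K j : ℕ) (x : ℝ) : ℝ :=
  φ j x - ∑ k ∈ Finset.range K, φ (j + k) 0 * (x ^ k / (k.factorial : ℝ))

section
variable {φ : ℕ → ℝ → ℝ}

lemma rem_cont (hc : ∀ k, ContinuousOn (φ k) (Icc 0 1)) (K j : ℕ) : ContinuousOn (rem φ K j) (Icc 0 1) := by
  unfold rem
  refine (hc j).sub (Continuous.continuousOn ?_)
  fun_prop

lemma rem_zero (K j : ℕ) : rem φ (K + 1) j 0 = 0 := by
  simp [rem, Finset.sum_range_succ']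

lemma rem_deriv (hd : ∀ k, ∀ x ∈ Ioo (0:ℝ) 1, HasDerivAt (φ k) (φ (k + 1) x) x) (K j : ℕ) (x : ℝ) (hx : x ∈ Ioo (0:ℝ) 1) :
    HasDerivAt (rem φ (K + 1) j) (rem φ K (j + 1) x) x := by
  unfold rem
  refine (hd j x hx).sub ?_
  have h1 : (fun x : ℝ => ∑ k ∈ Finset.range (K + 1), φ (j + k) 0 * (x ^ k / (k.factorial : ℝ)))
     = fun x => (∑ k ∈ Finset.range K, φ (j + 1 + k) 0 * (x ^ (k + 1) / ((k + 1).factorial : ℝ)))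
        + φ j 0 := by
    ext y
    rw [Finset.sum_range_succ']
    simp [add_assoc, add_comm 1]
  rw [h1]
  refine HasDerivAt.add_const _ (HasDerivAt.fun_sum fun k _ => ?_)
  refine HasDerivAt.const_mul _ ?_
  have := (hasDerivAt_pow (k + 1) x).div_const ((k + 1).factorial : ℝ)
  refine this.congr_deriv ?_
  rw [Nat.factorial_succ]
  have : (k.factorial : ℝ) ≠ 0 := by positivity
  push_cast
  field_simp

lemma rem_nonneg (hc : ∀ k, ContinuousOn (φ k) (Icc 0 1))
    (hd : ∀ k, ∀ x ∈ Ioo (0:ℝ) 1, HasDerivAt (φ k) (φ (k + 1) x) x)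
    (hn : ∀ k, ∀ x ∈ Icc (0:ℝ) 1, 0 ≤ φ k x) (K : ℕ) : ∀ j, ∀ x ∈ Icc (0:ℝ) 1, 0 ≤ rem φ K j x := by
  induction K with
  | zero => intro j x hx; simpa [rem] using hn j x hx
  | succ K ih =>
    intro j x hx
    rw [← rem_zero (φ := φ) K j]
    exact mono_le (rem_cont hc _ j) (rem_deriv hd K j)
      (fun y hy => ih (j + 1) y (Ioo_subset_Icc_self hy)) le_rfl hx.1 hx.2

lemma rem_scale (hc : ∀ k, ContinuousOn (φ k) (Icc 0 1))
    (hd : ∀ k, ∀ x ∈ Ioo (0:ℝ) 1, HasDerivAt (φ k) (φ (k + 1) x) x)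
    (hn : ∀ k, ∀ x ∈ Icc (0:ℝ) 1, 0 ≤ φ k x) (K : ℕ) : ∀ j, ∀ x ∈ Icc (0:ℝ) 1, ∀ l ∈ Ioo (0:ℝ) 1,
    rem φ K j (l * x) ≤ l ^ K * rem φ K j x := by
  induction K with
  | zero =>
    intro j x hx l hl
    simp only [rem, Finset.range_zero, Finset.sum_empty, sub_zero, pow_zero, one_mul]
    exact mono_le (hc j) (hd j) (fun y hy => hn (j + 1) y (Ioo_subset_Icc_self hy))
      (mul_nonneg hl.1.le hx.1) (by nlinarith [hl.2, hx.1]) hx.2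
  | succ K ih =>
    intro j x hx l hl
    have hmem : ∀ y ∈ Icc (0:ℝ) 1, l * y ∈ Icc (0:ℝ) 1 := fun y hy =>
      ⟨mul_nonneg hl.1.le hy.1, by nlinarith [hl.2, hy.1, hy.2, hl.1]⟩
    have hmem' : ∀ y ∈ Ioo (0:ℝ) 1, l * y ∈ Ioo (0:ℝ) 1 := fun y hy =>
      ⟨mul_pos hl.1 hy.1, by nlinarith [hl.2, hy.1, hy.2, hl.1]⟩
    have := mono_le (u := fun y => l ^ (K + 1) * rem φ (K + 1) j y - rem φ (K + 1) j (l * y))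
      (u' := fun y => l ^ (K + 1) * rem φ K (j + 1) y - rem φ K (j + 1) (l * y) * l)
      (((rem_cont hc _ j).const_smul (l ^ (K+1))).sub
        ((rem_cont hc _ j).comp (by fun_prop) hmem))
      (fun y hy => by
        refine ((rem_deriv hd K j y hy).const_mul _).sub ?_
        have h2 : HasDerivAt (fun y : ℝ => l * y) l y := by
          simpa using (hasDerivAt_id y).const_mul l
        exact (rem_deriv hd K j (l * y) (hmem' y hy)).comp y h2)
      (fun y hy => by
        have := ih (j + 1) y (Ioo_subset_Icc_self hy) l hl
        have := mul_le_mul_of_nonneg_right this hl.1.le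
        rw [pow_succ]; linarith)
      le_rfl hx.1 hx.2
    simp only [mul_zero, rem_zero, sub_zero] at this
    linarith

/-- Bernstein's little theorem, up to the endpoint. -/
lemma absmono_hasSum (hc : ∀ k, ContinuousOn (φ k) (Icc 0 1))
    (hd : ∀ k, ∀ x ∈ Ioo (0:ℝ) 1, HasDerivAt (φ k) (φ (k + 1) x) x)
    (hn : ∀ k, ∀ x ∈ Icc (0:ℝ) 1, 0 ≤ φ k x) : HasSum (fun k => φ k 0 / (k.factorial : ℝ)) (φ 0 1) := by
  have h0 : ∀ k, 0 ≤ φ k 0 := fun k => hn k 0 (by simp)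
  have hnn : ∀ k, 0 ≤ φ k 0 / (k.factorial : ℝ) := fun k => by have := h0 k; positivity
  have hle : ∀ K, ∑ k ∈ Finset.range K, φ k 0 / (k.factorial : ℝ) ≤ φ 0 1 := by
    intro K
    have := rem_nonneg hc hd hn K 0 1 (by simp)
    simp only [rem, one_pow, zero_add, mul_one_div] at this
    linarith
  have hs : Summable (fun k => φ k 0 / (k.factorial : ℝ)) :=
    summable_of_sum_range_le hnn hle
  have hup : ∑' k, φ k 0 / (k.factorial : ℝ) ≤ φ 0 1 := Real.tsum_le_of_sum_range_le hnn hle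
  have hlow : ∀ l ∈ Ioo (0:ℝ) 1, φ 0 l ≤ ∑' k, φ k 0 / (k.factorial : ℝ) := by
    intro l hl
    have hK : ∀ K : ℕ, φ 0 l ≤ ∑' k, φ k 0 / (k.factorial : ℝ) + l ^ K * φ 0 1 := by
      intro K
      have h1 := rem_scale hc hd hn K 0 1 (by simp) l hl
      have h2 : rem φ K 0 1 ≤ φ 0 1 := by
        simp only [rem, one_pow, zero_add, mul_one_div]
        have := Finset.sum_nonneg (fun k (_ : k ∈ Finset.range K) => hnn k)
        linarith
      have h3 : ∑ k ∈ Finset.range K, φ (0 + k) 0 * (l ^ k / (k.factorial : ℝ))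
          ≤ ∑ k ∈ Finset.range K, φ k 0 / (k.factorial : ℝ) := by
        refine Finset.sum_le_sum fun k _ => ?_
        rw [zero_add, ← mul_div_assoc]
        have : l ^ k ≤ 1 := pow_le_one₀ hl.1.le hl.2.le
        have := h0 k
        gcongr
        nlinarith
      have h4 := hs.sum_le_tsum (Finset.range K) (fun k _ => hnn k)
      have h5 := mul_le_mul_of_nonneg_left h2 (pow_nonneg hl.1.le K)
      rw [mul_one] at h1
      have h6 : φ 0 l = rem φ K 0 l
        + ∑ k ∈ Finset.range K, φ (0 + k) 0 * (l ^ k / (k.factorial : ℝ)) := by simp [rem]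
      linarith
    have ht : Tendsto (fun K : ℕ => ∑' k, φ k 0 / (k.factorial : ℝ) + l ^ K * φ 0 1) atTop
        (𝓝 (∑' k, φ k 0 / (k.factorial : ℝ) + 0 * φ 0 1)) :=
      ((tendsto_pow_atTop_nhds_zero_of_lt_one hl.1.le hl.2).mul_const _).const_add _
    simpa using ge_of_tendsto' ht hK
  have hfin : φ 0 1 ≤ ∑' k, φ k 0 / (k.factorial : ℝ) := by
    have hcw : Tendsto (φ 0) (𝓝[Ioo 0 1] 1) (𝓝 (φ 0 1)) :=
      ((hc 0) 1 (by simp)).mono Ioo_subset_Icc_self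
    have : (𝓝[Ioo (0:ℝ) 1] 1).NeBot := by
      rw [nhdsWithin_Ioo_eq_nhdsLT one_pos]; infer_instance
    exact le_of_tendsto hcw (eventually_mem_nhdsWithin.mono hlow)
  rw [← le_antisymm hup hfin]
  exact hs.hasSum
end

/-! ### Gaussian integration by parts -/

lemma hasDerivAt_pdf (x : ℝ) :
    HasDerivAt (gaussianPDFReal 0 1) (-(x * gaussianPDFReal 0 1 x)) x := by
  have h : gaussianPDFReal 0 1 = fun x : ℝ => (√(2 * Real.pi))⁻¹ * Real.exp (-(x ^ 2) / 2) := by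
    ext y; simp [gaussianPDFReal]
  rw [h]
  have h1 : HasDerivAt (fun x : ℝ => -(x ^ 2) / 2) (-x) x := by
    have := ((hasDerivAt_pow 2 x).neg).div_const 2
    refine this.congr_deriv ?_
    norm_num
    ring
  have := (h1.exp).const_mul (√(2 * Real.pi))⁻¹
  refine this.congr_deriv ?_
  ring

lemma integrable_id_mul_pdf : Integrable (fun x : ℝ => x * gaussianPDFReal 0 1 x) := by
  have h : gaussianPDFReal 0 1 = fun x : ℝ => (√(2 * Real.pi))⁻¹ * Real.exp (-(1/2) * x ^ 2) := by
    ext y; simp [gaussianPDFReal]; left; ring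
  rw [h]
  have := (integrable_mul_exp_neg_mul_sq (b := 1/2) (by norm_num)).const_mul (√(2 * Real.pi))⁻¹
  refine this.congr (Eventually.of_forall fun x => ?_)
  simp only; ring

lemma stein_one {u u' : ℝ → ℝ} (hu : ∀ x, HasDerivAt u (u' x) x) {C C' : ℝ}
    (hC : ∀ x, |u x| ≤ C) (hC' : ∀ x, |u' x| ≤ C') :
    ∫ x, x * u x ∂(gaussianReal 0 1) = ∫ x, u' x ∂(gaussianReal 0 1) := by
  have hcont : Continuous u := continuous_iff_continuousAt.2 fun x => (hu x).continuousAt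
  have hmeas' : Measurable u' := by
    have : u' = deriv u := by ext x; exact (hu x).deriv.symm
    rw [this]; exact measurable_deriv u
  have hp := integrable_gaussianPDFReal 0 1
  have key := integral_mul_deriv_eq_deriv_mul_of_integrable (u := u) (u' := u')
    (v := gaussianPDFReal 0 1) (v' := fun x => -(x * gaussianPDFReal 0 1 x))
    (fun x _ => hu x) (fun x _ => hasDerivAt_pdf x)
    (integrable_id_mul_pdf.neg.bdd_mul hcont.aestronglyMeasurable
      (Eventually.of_forall (fun x => hC x)))
    (hp.bdd_mul hmeas'.aestronglyMeasurable (Eventually.of_forall (fun x => hC' x)))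
    (hp.bdd_mul hcont.aestronglyMeasurable (Eventually.of_forall (fun x => hC x)))
  rw [integral_gaussianReal_eq_integral_smul one_ne_zero,
    integral_gaussianReal_eq_integral_smul one_ne_zero]
  have e1 : ∫ x, gaussianPDFReal 0 1 x • (x * u x)
      = - ∫ x, u x * -(x * gaussianPDFReal 0 1 x) := by
    rw [← integral_neg]; congr 1; ext x; simp only [smul_eq_mul]; ring
  rw [e1, key, neg_neg]
  congr 1; ext x; simp only [smul_eq_mul]; ring

/-- standard Gaussian measure -/
noncomputable abbrev γ (n : ℕ) : Measure (Fin n → ℝ) := Measure.pi fun _ : Fin n => gaussianReal 0 1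

lemma integrable_coord {n : ℕ} (i : Fin n) : Integrable (fun x : Fin n → ℝ => x i) (γ n) := by
  have h : Integrable (fun x : ℝ => x) (gaussianReal 0 1) :=
    (memLp_id_gaussianReal' 1 (by simp)).integrable le_rfl
  exact integrable_comp_eval (μ := fun _ : Fin n => gaussianReal 0 1) (i := i) h

lemma stein {n : ℕ} (i : Fin n) {F F' : (Fin n → ℝ) → ℝ} (hF : Continuous F) (hF' : Continuous F')
    (hd : ∀ x, HasDerivAt (fun s => F (Function.update x i s)) (F' x) (x i))
    {C C' : ℝ} (hC : ∀ x, |F x| ≤ C) (hC' : ∀ x, |F' x| ≤ C') :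
    ∫ x, x i * F x ∂(γ n) = ∫ x, F' x ∂(γ n) := by
  obtain _ | m := n
  · exact i.elim0
  have hmp := measurePreserving_piFinSuccAbove (fun _ : Fin (m+1) => gaussianReal 0 1) i
  have hmp' := hmp.symm
  have i1 : Integrable (fun x : Fin (m+1) → ℝ => x i * F x) (γ (m+1)) :=
    (integrable_coord i).mul_bdd hF.aestronglyMeasurable (Eventually.of_forall hC)
  have i2 : Integrable F' (γ (m+1)) :=
    (integrable_const C').mono' hF'.aestronglyMeasurable (Eventually.of_forall hC')
  rw [← hmp'.integral_comp' (fun x => x i * F x), ← hmp'.integral_comp' F']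
  have j1 := (hmp'.integrable_comp_emb (MeasurableEquiv.measurableEmbedding _)).2 i1
  have j2 := (hmp'.integrable_comp_emb (MeasurableEquiv.measurableEmbedding _)).2 i2
  refine (integral_prod_symm _ j1).trans (Eq.trans ?_ (integral_prod_symm _ j2).symm)
  congr 1
  ext y
  have := stein_one (u := fun s => F (i.insertNth s y)) (u' := fun s => F' (i.insertNth s y))
    (C := C) (C' := C') (fun s => by
      have := hd (i.insertNth s y)
      simpa [Fin.update_insertNth] using this) (fun s => hC _) (fun s => hC' _)
  have hsymm : ∀ s : ℝ, (MeasurableEquiv.piFinSuccAbove (fun _ : Fin (m+1) => ℝ) i).symm (s, y)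
      = i.insertNth s y := fun s => rfl
  simp only [Function.comp_apply, hsymm, Fin.insertNth_apply_same]
  exact this
end HermiteAux

namespace HermiteAux
open Filter Topology Set

/-- smooth with all derivatives bounded -/
structure BD {n : ℕ} (f : (Fin n → ℝ) → ℝ) : Prop where
  smooth : ContDiff ℝ (⊤ : ℕ∞) f
  bd : ∀ k : ℕ, ∃ C : ℝ, ∀ x, ‖iteratedFDeriv ℝ k f x‖ ≤ C

/-- partial derivative -/
noncomputable def pd {n : ℕ} (i : Fin n) (f : (Fin n → ℝ) → ℝ) : (Fin n → ℝ) → ℝ :=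
  fun x => fderiv ℝ f x (Pi.single i 1)

variable {n : ℕ} {f : (Fin n → ℝ) → ℝ}

lemma BD.pd (hf : BD f) (i : Fin n) : BD (pd i f) := by
  have h1 : ContDiff ℝ (⊤ : ℕ∞) (fderiv ℝ f) := hf.smooth.fderiv_right (by simp)
  refine ⟨h1.clm_apply contDiff_const, fun k => ?_⟩
  obtain ⟨C, hC⟩ := hf.bd (k + 1)
  refine ⟨‖(Pi.single i 1 : Fin n → ℝ)‖ * C, fun x => ?_⟩
  refine (norm_iteratedFDeriv_clm_apply_const h1.contDiffAt
    (by exact_mod_cast le_top)).trans ?_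
  rw [norm_iteratedFDeriv_fderiv]
  gcongr
  exact hC x

lemma BD.bdd (hf : BD f) : ∃ C : ℝ, ∀ x, |f x| ≤ C := by
  obtain ⟨C, hC⟩ := hf.bd 0
  exact ⟨C, fun x => by simpa [norm_iteratedFDeriv_zero] using hC x⟩

lemma BD.cont (hf : BD f) : Continuous f := hf.smooth.continuous

lemma BD.fderiv (hf : BD f) (x : Fin n → ℝ) : HasFDerivAt f (fderiv ℝ f x) x :=
  (hf.smooth.differentiable (by simp)).differentiableAt.hasFDerivAt

lemma fderiv_eq_sum (x v : Fin n → ℝ) :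
    fderiv ℝ f x v = ∑ i, v i * HermiteAux.pd i f x := by
  conv_lhs => rw [pi_eq_sum_univ' v]
  simp [HermiteAux.pd, map_sum]

/-- the interpolation semigroup -/
noncomputable def A (f : (Fin n → ℝ) → ℝ) (t : ℝ) (w : Fin n → ℝ) : ℝ :=
  ∫ z, f (√t • w + √(1 - t) • z) ∂(γ n)

lemma A_bdd {C : ℝ} (hC : ∀ x, |f x| ≤ C) (t : ℝ) (w : Fin n → ℝ) : |A f t w| ≤ C := by
  have := norm_integral_le_of_norm_le_const (μ := γ n) (C := C)
    (f := fun z => f (√t • w + √(1 - t) • z)) (Eventually.of_forall fun z => hC _)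
  simpa [A] using this

lemma A_cont (hf : BD f) : Continuous (fun p : ℝ × (Fin n → ℝ) => A f p.1 p.2) := by
  obtain ⟨C, hC⟩ := hf.bdd
  have hfc := hf.cont
  unfold A
  refine continuous_of_dominated (bound := fun _ => C) (fun p => ?_) (fun p => ?_)
    (integrable_const C) (Eventually.of_forall fun z => ?_)
  · exact Continuous.aestronglyMeasurable (by fun_prop)
  · exact Eventually.of_forall fun z => hC _
  · fun_prop

lemma A_cont_right (hf : BD f) (t : ℝ) : Continuous (A f t) :=
  (A_cont hf).comp (by fun_prop : Continuous fun w : Fin n → ℝ => (t, w))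

lemma A_cont_left (hf : BD f) (w : Fin n → ℝ) : Continuous (fun t => A f t w) :=
  (A_cont hf).comp (by fun_prop : Continuous fun t : ℝ => (t, w))

lemma integrable_of_bdd {g : (Fin n → ℝ) → ℝ} (hg : Continuous g) {C : ℝ} (hC : ∀ x, |g x| ≤ C) :
    Integrable g (γ n) :=
  (integrable_const C).mono' hg.aestronglyMeasurable (Eventually.of_forall hC)

lemma A_hasDerivAt_space (hf : BD f) (t : ℝ) (i : Fin n) (w : Fin n → ℝ) :
    HasDerivAt (fun s => A f t (Function.update w i s)) (√t * A (pd i f) t w) (w i) := by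
  obtain ⟨C, hC⟩ := hf.bdd
  obtain ⟨C', hC'⟩ := (hf.pd i).bdd
  have hfc := hf.cont
  have hfc' := (hf.pd i).cont
  have key := hasDerivAt_integral_of_dominated_loc_of_deriv_le (μ := γ n) (x₀ := w i)
    (F := fun s z => f (√t • Function.update w i s + √(1 - t) • z))
    (F' := fun s z => √t * pd i f (√t • Function.update w i s + √(1 - t) • z))
    (s := univ) (bound := fun _ => √t * C') univ_mem
    (Eventually.of_forall fun s => Continuous.aestronglyMeasurable (by fun_prop))
    (integrable_of_bdd (C := C) (by fun_prop) (fun z => hC _))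
    (Continuous.aestronglyMeasurable (by fun_prop))
    (Eventually.of_forall fun z s _ => by
      rw [norm_mul, Real.norm_of_nonneg (Real.sqrt_nonneg t)]
      exact mul_le_mul_of_nonneg_left (hC' _) (Real.sqrt_nonneg t))
    (integrable_const _)
    (Eventually.of_forall fun z s _ => by
      have h1 : HasDerivAt (fun s => √t • Function.update w i s + √(1 - t) • z)
          (√t • Pi.single i 1) s :=
        ((hasDerivAt_update w i s).const_smul (√t)).add_const _
      have := (hf.fderiv _).comp_hasDerivAt s h1
      refine this.congr_deriv ?_
      simp [pd])
  have := key.2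
  simp only [Function.update_eq_self, integral_const_mul] at this
  exact this

lemma exists_nhds {t : ℝ} (ht : t ∈ Ioo (0:ℝ) 1) : ∃ c : ℝ, ∃ s ∈ 𝓝 t, s ⊆ Ioo (0:ℝ) 1 ∧
    0 ≤ c ∧ ∀ r ∈ s, 1 / (2 * √r) ≤ c ∧ 1 / (2 * √(1 - r)) ≤ c := by
  have h1 : ContinuousAt (fun r => 1 / (2 * √r)) t := by
    refine ContinuousAt.div (by fun_prop) (by fun_prop) ?_
    have := Real.sqrt_pos.2 ht.1
    positivity
  have h2 : ContinuousAt (fun r => 1 / (2 * √(1 - r))) t := by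
    refine ContinuousAt.div (by fun_prop) (by fun_prop) ?_
    have := Real.sqrt_pos.2 (sub_pos.2 ht.2)
    positivity
  refine ⟨max (1 / (2 * √t) + 1) (1 / (2 * √(1 - t)) + 1),
    {r | r ∈ Ioo (0:ℝ) 1 ∧ 1 / (2 * √r) < 1 / (2 * √t) + 1 ∧
      1 / (2 * √(1 - r)) < 1 / (2 * √(1 - t)) + 1}, ?_, fun r hr => hr.1, ?_, ?_⟩
  · filter_upwards [isOpen_Ioo.mem_nhds ht, h1.eventually_lt_const (lt_add_one _),
      h2.eventually_lt_const (lt_add_one _)] with r a b c using ⟨a, b, c⟩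
  · exact le_max_of_le_left (by positivity)
  · rintro r ⟨_, h, h'⟩
    exact ⟨h.le.trans (le_max_left _ _), h'.le.trans (le_max_right _ _)⟩

/-- the time derivative of `A` -/
noncomputable def A' (f : (Fin n → ℝ) → ℝ) (t : ℝ) (w : Fin n → ℝ) : ℝ :=
  ∑ i, (w i * (1 / (2 * √t)) * A (pd i f) t w - 1 / 2 * A (pd i (pd i f)) t w)

lemma pd_hasDerivAt (hf : BD f) (i : Fin n) (t : ℝ) (w z : Fin n → ℝ) :
    HasDerivAt (fun s => f (√t • w + √(1 - t) • Function.update z i s))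
      (√(1 - t) * pd i f (√t • w + √(1 - t) • z)) (z i) := by
  have h1 : HasDerivAt (fun s => √t • w + √(1 - t) • Function.update z i s)
      (√(1 - t) • Pi.single i 1) (z i) :=
    ((hasDerivAt_update z i (z i)).const_smul (√(1 - t))).const_add _
  have := (hf.fderiv _).comp_hasDerivAt (z i) h1
  refine this.congr_deriv ?_
  simp [pd]

lemma A_hasDerivAt_time (hf : BD f) (w : Fin n → ℝ) {t : ℝ} (ht : t ∈ Ioo (0:ℝ) 1) :
    HasDerivAt (fun t => A f t w) (A' f t w) t := by
  obtain ⟨C, hC⟩ := hf.bdd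
  choose C' hC' using fun i => (hf.pd i).bdd
  choose C'' hC'' using fun i => ((hf.pd i).pd i).bdd
  have hfc := hf.cont
  have hfc' := fun i => (hf.pd i).cont
  obtain ⟨c, s, hs, hs1, hc0, hc⟩ := exists_nhds ht
  have hi1 : ∀ i, Integrable (fun z => w i * (1 / (2 * √t)) * pd i f (√t • w + √(1 - t) • z))
      (γ n) := fun i => by
    refine Integrable.const_mul (integrable_of_bdd (C := C' i) ?_ (fun z => hC' i _)) _
    have := hfc' i
    fun_prop
  have hi2 : ∀ i, Integrable (fun z => z i * pd i f (√t • w + √(1 - t) • z)) (γ n) := fun i => by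
    refine (integrable_coord i).mul_bdd (Continuous.aestronglyMeasurable ?_)
      (Eventually.of_forall fun z => hC' i _)
    have := hfc' i
    fun_prop
  have key := hasDerivAt_integral_of_dominated_loc_of_deriv_le (μ := γ n) (x₀ := t)
    (F := fun t z => f (√t • w + √(1 - t) • z))
    (F' := fun t z => ∑ i, (w i * (1 / (2 * √t)) - z i * (1 / (2 * √(1 - t)))) *
      pd i f (√t • w + √(1 - t) • z))
    (s := s) (bound := fun z => ∑ i, (|w i| * c + |z i| * c) * C' i) hs
    (Eventually.of_forall fun s => Continuous.aestronglyMeasurable (by fun_prop))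
    (integrable_of_bdd (C := C) (by fun_prop) (fun z => hC _))
    (Continuous.aestronglyMeasurable (by fun_prop))
    (Eventually.of_forall fun z r hr => by
      refine (norm_sum_le _ _).trans (Finset.sum_le_sum fun i _ => ?_)
      rw [norm_mul]
      obtain ⟨a, b⟩ := hc r hr
      refine mul_le_mul ((norm_sub_le _ _).trans (add_le_add ?_ ?_)) (hC' i _) (norm_nonneg _)
        (by positivity)
      · rw [norm_mul, Real.norm_of_nonneg (by positivity : 0 ≤ 1 / (2 * √r))]
        exact mul_le_mul_of_nonneg_left a (abs_nonneg _)
      · rw [norm_mul, Real.norm_of_nonneg (by positivity : 0 ≤ 1 / (2 * √(1 - r)))]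
        exact mul_le_mul_of_nonneg_left b (abs_nonneg _))
    (integrable_finsetSum _ fun i _ =>
      ((integrable_const _).add ((integrable_coord i).abs.mul_const c)).mul_const _)
    (Eventually.of_forall fun z r hr => by
      have hr0 := hs1 hr
      have h1 := (Real.hasDerivAt_sqrt hr0.1.ne').smul_const w
      have h2 : HasDerivAt (fun r : ℝ => √(1 - r)) (-(1 / (2 * √(1 - r)))) r := by
        have h3 : HasDerivAt (fun r : ℝ => 1 - r) (-1) r := by
          simpa using (hasDerivAt_id r).const_sub 1
        have := h3.sqrt (sub_pos.2 hr0.2).ne'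
        refine this.congr_deriv (by ring)
      have h4 := h1.add (h2.smul_const z)
      have := (hf.fderiv _).comp_hasDerivAt r h4
      refine this.congr_deriv ?_
      rw [fderiv_eq_sum]
      refine Finset.sum_congr rfl fun i _ => ?_
      simp only [Pi.add_apply, Pi.smul_apply, smul_eq_mul]
      ring)
  refine key.2.congr_deriv ?_
  have hst : ∀ i, ∫ z, z i * pd i f (√t • w + √(1 - t) • z) ∂(γ n)
      = √(1 - t) * A (pd i (pd i f)) t w := fun i => by
    have hc1 := hfc' i
    have hc2 := ((hf.pd i).pd i).cont
    rw [A, ← integral_const_mul]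
    refine stein i (F := fun z => pd i f (√t • w + √(1 - t) • z)) (by fun_prop) (by fun_prop)
      (fun z => pd_hasDerivAt (hf.pd i) i t w z) (C := C' i) (C' := √(1 - t) * C'' i)
      (fun z => hC' i _) (fun z => ?_)
    rw [abs_mul, abs_of_nonneg (Real.sqrt_nonneg _)]
    exact mul_le_mul_of_nonneg_left (hC'' i _) (Real.sqrt_nonneg _)
  have hsq : √(1 - t) ≠ 0 := (Real.sqrt_pos.2 (sub_pos.2 ht.2)).ne'
  have e : ∀ i (z : Fin n → ℝ), (w i * (1 / (2 * √t)) - z i * (1 / (2 * √(1 - t)))) *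
      pd i f (√t • w + √(1 - t) • z) = w i * (1 / (2 * √t)) * pd i f (√t • w + √(1 - t) • z)
        - 1 / (2 * √(1 - t)) * (z i * pd i f (√t • w + √(1 - t) • z)) := fun i z => by ring
  simp only [e]
  refine (integral_finsetSum _ fun i _ => (hi1 i).sub ((hi2 i).const_mul _)).trans ?_
  rw [A']
  refine Finset.sum_congr rfl fun i _ => ?_
  refine (integral_sub (hi1 i) ((hi2 i).const_mul _)).trans ?_
  rw [integral_const_mul, integral_const_mul, hst i]
  rw [← A]
  field_simp

/-- the interpolated second moment -/
noncomputable def Φ (f : (Fin n → ℝ) → ℝ) (t : ℝ) : ℝ := ∫ w, A f t w ^ 2 ∂(γ n)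

lemma Φ_nonneg (t : ℝ) : 0 ≤ Φ f t := integral_nonneg fun w => sq_nonneg _

lemma Φ_cont (hf : BD f) : Continuous (Φ f) := by
  obtain ⟨C, hC⟩ := hf.bdd
  unfold Φ
  refine continuous_of_dominated (bound := fun _ => C ^ 2) (fun t => ?_) (fun t => ?_)
    (integrable_const _) (Eventually.of_forall fun w => ?_)
  · exact ((A_cont_right hf t).pow 2).aestronglyMeasurable
  · refine Eventually.of_forall fun w => ?_
    rw [norm_pow]
    exact pow_le_pow_left₀ (norm_nonneg _) (A_bdd hC t w) 2
  · exact (A_cont_left hf w).pow 2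

lemma Φ_hasDerivAt (hf : BD f) {t : ℝ} (ht : t ∈ Ioo (0:ℝ) 1) :
    HasDerivAt (Φ f) (∑ i, Φ (pd i f) t) t := by
  obtain ⟨C, hC⟩ := hf.bdd
  choose C' hC' using fun i => (hf.pd i).bdd
  choose C'' hC'' using fun i => ((hf.pd i).pd i).bdd
  have hc0 := A_cont_right hf t
  have hc1 := fun i => A_cont_right (hf.pd i) t
  have hc2 := fun i => A_cont_right ((hf.pd i).pd i) t
  have hC0 : 0 ≤ C := (abs_nonneg _).trans (hC 0)
  obtain ⟨c, s, hs, hs1, hcc, hc⟩ := exists_nhds ht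
  have key := hasDerivAt_integral_of_dominated_loc_of_deriv_le (μ := γ n) (x₀ := t)
    (F := fun t w => A f t w ^ 2)
    (F' := fun t w => 2 * A f t w * A' f t w)
    (s := s) (bound := fun w => 2 * C * ∑ i, (|w i| * c * C' i + 1 / 2 * C'' i)) hs
    (Eventually.of_forall fun s => ((A_cont_right hf s).pow 2).aestronglyMeasurable)
    (integrable_of_bdd (C := C ^ 2) (hc0.pow 2) (fun w => by
      rw [abs_pow]; exact pow_le_pow_left₀ (abs_nonneg _) (A_bdd hC t w) 2))
    (Continuous.aestronglyMeasurable (by unfold A'; fun_prop))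
    (Eventually.of_forall fun w r hr => by
      rw [norm_mul, norm_mul]
      obtain ⟨a, b⟩ := hc r hr
      refine mul_le_mul (mul_le_mul (by simp) (A_bdd hC r w) (norm_nonneg _) (by simp))
        ((norm_sum_le _ _).trans (Finset.sum_le_sum fun i _ => ?_)) (norm_nonneg _) (by positivity)
      refine (norm_sub_le _ _).trans (add_le_add ?_ ?_)
      · rw [norm_mul, norm_mul, Real.norm_of_nonneg (by positivity : 0 ≤ 1 / (2 * √r))]
        exact mul_le_mul (mul_le_mul_of_nonneg_left a (abs_nonneg _)) (A_bdd (hC' i) r w)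
          (norm_nonneg _) (by positivity)
      · rw [norm_mul]
        exact mul_le_mul (by norm_num) (A_bdd (hC'' i) r w) (norm_nonneg _) (by norm_num))
    ((integrable_finsetSum _ fun i _ =>
      (((integrable_coord i).abs.mul_const c).mul_const _).add (integrable_const _)).const_mul _)
    (Eventually.of_forall fun w r hr => by
      have := (A_hasDerivAt_time hf w (hs1 hr)).pow 2
      refine this.congr_deriv ?_
      norm_num)
  refine key.2.congr_deriv ?_
  have hb1 : ∀ i w, |A f t w * A (pd i f) t w| ≤ C * C' i := fun i w => by
    rw [abs_mul]
    exact mul_le_mul (A_bdd hC t w) (A_bdd (hC' i) t w) (abs_nonneg _) hC0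
  have hb2 : ∀ i w, |A f t w * A (pd i (pd i f)) t w| ≤ C * C'' i := fun i w => by
    rw [abs_mul]
    exact mul_le_mul (A_bdd hC t w) (A_bdd (hC'' i) t w) (abs_nonneg _) hC0
  have hb3 : ∀ i w, |A (pd i f) t w ^ 2| ≤ C' i ^ 2 := fun i w => by
    rw [abs_pow]; exact pow_le_pow_left₀ (abs_nonneg _) (A_bdd (hC' i) t w) 2
  have hi1 : ∀ i, Integrable (fun w => w i * (A f t w * A (pd i f) t w)) (γ n) := fun i =>
    (integrable_coord i).mul_bdd (hc0.mul (hc1 i)).aestronglyMeasurable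
      (Eventually.of_forall (hb1 i))
  have hi2 : ∀ i, Integrable (fun w => A f t w * A (pd i (pd i f)) t w) (γ n) := fun i =>
    integrable_of_bdd (hc0.mul (hc2 i)) (hb2 i)
  have hi3 : ∀ i, Integrable (fun w => A (pd i f) t w ^ 2) (γ n) := fun i =>
    integrable_of_bdd ((hc1 i).pow 2) (hb3 i)
  have hst : ∀ i, ∫ w, w i * (A f t w * A (pd i f) t w) ∂(γ n)
      = √t * (Φ (pd i f) t + ∫ w, A f t w * A (pd i (pd i f)) t w ∂(γ n)) := fun i => by
    rw [Φ, ← integral_add (hi3 i) (hi2 i), ← integral_const_mul]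
    refine stein i (F := fun w => A f t w * A (pd i f) t w)
      (hc0.mul (hc1 i)) (continuous_const.mul (((hc1 i).pow 2).add (hc0.mul (hc2 i))))
      (fun w => ?_) (hb1 i) (C' := √t * (C' i ^ 2 + C * C'' i)) (fun w => ?_)
    · have := (A_hasDerivAt_space hf t i w).mul (A_hasDerivAt_space (hf.pd i) t i w)
      refine this.congr_deriv ?_
      simp only [Function.update_eq_self]
      ring
    · rw [abs_mul, abs_of_nonneg (Real.sqrt_nonneg _)]
      exact mul_le_mul_of_nonneg_left ((abs_add_le _ _).trans (add_le_add (hb3 i w) (hb2 i w)))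
        (Real.sqrt_nonneg _)
  have hsq : √t ≠ 0 := (Real.sqrt_pos.2 ht.1).ne'
  have e : ∀ w, 2 * A f t w * A' f t w = ∑ i, (1 / √t * (w i * (A f t w * A (pd i f) t w))
      - A f t w * A (pd i (pd i f)) t w) := fun w => by
    rw [A', Finset.mul_sum]
    refine Finset.sum_congr rfl fun i _ => ?_
    field_simp
  simp only [e]
  refine (integral_finsetSum _ fun i _ => ((hi1 i).const_mul _).sub (hi2 i)).trans ?_
  refine Finset.sum_congr rfl fun i _ => ?_
  refine (integral_sub ((hi1 i).const_mul _) (hi2 i)).trans ?_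
  rw [integral_const_mul, hst i]
  field_simp
  ring

lemma Φ_zero : Φ f 0 = (∫ x, f x ∂(γ n)) ^ 2 := by
  simp [Φ, A]

lemma Φ_one : Φ f 1 = ∫ x, f x ^ 2 ∂(γ n) := by
  simp [Φ, A]

/-- iterated partial derivatives -/
noncomputable def ipd (f : (Fin n → ℝ) → ℝ) (k : ℕ) (i : Fin k → Fin n) : (Fin n → ℝ) → ℝ :=
  fun x => iteratedFDeriv ℝ k f x (fun j => Pi.single (i j) 1)

lemma ipd_succ (hf : BD f) (k : ℕ) (a : Fin n) (i : Fin k → Fin n) :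
    ipd f (k + 1) (Fin.cons a i) = pd a (ipd f k i) := by
  ext x
  have hd : DifferentiableAt ℝ (iteratedFDeriv ℝ k f) x :=
    (hf.smooth.differentiable_iteratedFDeriv (by exact_mod_cast ENat.natCast_lt_top k)).differentiableAt
  unfold ipd pd
  rw [hd.iteratedFDeriv_succ_apply_left']
  rfl

lemma ipd_BD (hf : BD f) (k : ℕ) : ∀ i : Fin k → Fin n, BD (ipd f k i) := by
  induction k with
  | zero => intro i; exact hf
  | succ k ih =>
    intro i
    rw [← Fin.cons_self_tail i, ipd_succ hf]
    exact (ih _).pd _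

lemma hasSum_all (hf : BD f) : HasSum (fun k : ℕ => (∑ i : Fin k → Fin n, Φ (ipd f k i) 0) /
    (k.factorial : ℝ)) (∑ i : Fin 0 → Fin n, Φ (ipd f 0 i) 1) := by
  refine absmono_hasSum (φ := fun k t => ∑ i : Fin k → Fin n, Φ (ipd f k i) t) ?_ ?_ ?_
  · intro k
    exact (continuous_finsetSum _ fun i _ => Φ_cont (ipd_BD hf k i)).continuousOn
  · intro k t ht
    refine (HasDerivAt.fun_sum fun i _ => Φ_hasDerivAt (ipd_BD hf k i) ht).congr_deriv ?_
    rw [← (Fin.consEquiv (fun _ : Fin (k + 1) => Fin n)).sum_comp, Fintype.sum_prod_type,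
      Finset.sum_comm]
    refine Finset.sum_congr rfl fun i _ => Finset.sum_congr rfl fun a _ => ?_
    rw [← ipd_succ hf]
    rfl
  · intro k t _
    exact Finset.sum_nonneg fun i _ => Φ_nonneg t

end HermiteAux

theorem hermite_parseval_variance (n : ℕ) (f : (Fin n → ℝ) → ℝ)
    (hf : ContDiff ℝ (⊤ : ℕ∞) f)
    (hbd : ∀ k : ℕ, ∃ C : ℝ, ∀ x, ‖iteratedFDeriv ℝ k f x‖ ≤ C) :
    HasSum (fun k : ℕ =>
        (1 / ((k + 1).factorial : ℝ)) * ∑ i : Fin (k + 1) → Fin n,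
          (∫ x, iteratedFDeriv ℝ (k + 1) f x (fun j => Pi.single (i j) 1)
              ∂(Measure.pi fun _ : Fin n => gaussianReal 0 1)) ^ 2)
      (variance f (Measure.pi fun _ : Fin n => gaussianReal 0 1)) := by
  have hB : HermiteAux.BD f := ⟨hf, hbd⟩
  have h := HermiteAux.hasSum_all hB
  rw [← hasSum_nat_add_iff' 1] at h
  obtain ⟨C, hC⟩ := hB.bdd
  have hL : MemLp f 2 (HermiteAux.γ n) :=
    MemLp.of_bound hB.cont.aestronglyMeasurable C (Filter.Eventually.of_forall hC)
  have e0 : HermiteAux.ipd f 0 = fun _ => f := rfl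
  rw [variance_eq_sub hL]
  have e1 : (fun k : ℕ =>
        (1 / ((k + 1).factorial : ℝ)) * ∑ i : Fin (k + 1) → Fin n,
          (∫ x, iteratedFDeriv ℝ (k + 1) f x (fun j => Pi.single (i j) 1)
              ∂(Measure.pi fun _ : Fin n => gaussianReal 0 1)) ^ 2)
      = fun k : ℕ => (∑ i, HermiteAux.Φ (HermiteAux.ipd f (k + 1) i) 0) /
          ((k + 1).factorial : ℝ) := by
    funext k
    simp only [HermiteAux.Φ_zero, HermiteAux.ipd]
    rw [one_div_mul_eq_div]
  rw [e1]
  have e2 : (∑ i : Fin 0 → Fin n, HermiteAux.Φ (HermiteAux.ipd f 0 i) 1 -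
      ∑ i ∈ Finset.range 1, (∑ j : Fin i → Fin n, HermiteAux.Φ (HermiteAux.ipd f i j) 0) /
        (i.factorial : ℝ))
      = ∫ x, (f ^ 2) x ∂HermiteAux.γ n - (∫ x, f x ∂HermiteAux.γ n) ^ 2 := by
    simp [e0, HermiteAux.Φ_zero, HermiteAux.Φ_one]
  rw [← e2]
  exact h
end

section
/- Let g = (g_1, …, g_n) be i.i.d. standard Gaussian random variables and f : ℝⁿ → ℝ a C^∞ function with bounded derivatives of all orders. Then Σ_{1 ≤ i,j ≤ n} (E[∂⁴f/∂g_i²∂g_j²])² ≤ 4! · Var(f(g)). -/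
open MeasureTheory ProbabilityTheory

lemma stein1 (u u' : ℝ → ℝ) (h : ∀ x, HasDerivAt u (u' x) x)
    (h0 : Integrable u (gaussianReal 0 1)) (h1 : Integrable u' (gaussianReal 0 1))
    (h2 : Integrable (fun x => x * u x) (gaussianReal 0 1)) :
    ∫ x, x * u x ∂(gaussianReal 0 1) = ∫ x, u' x ∂(gaussianReal 0 1) := by
  have key : ∀ w : ℝ → ℝ, Integrable w (gaussianReal 0 1) ↔
      Integrable (fun x => w x * gaussianPDFReal 0 1 x) := by
    intro w
    rw [gaussianReal_of_var_ne_zero _ (one_ne_zero), 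
      integrable_withDensity_iff_integrable_smul' (measurable_gaussianPDF _ _)
        (Filter.Eventually.of_forall fun x => gaussianPDF_lt_top)]
    simp [toReal_gaussianPDF, mul_comm]
  rw [key] at h0 h1 h2
  rw [integral_gaussianReal_eq_integral_smul one_ne_zero,
    integral_gaussianReal_eq_integral_smul one_ne_zero]
  have hv : ∀ x, HasDerivAt (gaussianPDFReal 0 1) (-(x * gaussianPDFReal 0 1 x)) x := by
    intro x
    have : HasDerivAt (fun x : ℝ => -(x-0)^2/(2*((1:NNReal):ℝ))) (-x) x := by
      have := (((hasDerivAt_id x).sub_const 0).pow 2).neg.div_const (2*((1:NNReal):ℝ))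
      convert! this using 1
      simp only [id, NNReal.coe_one]
      norm_num
      ring
    have := (this.exp).const_mul (√(2 * Real.pi * (1:NNReal)))⁻¹
    convert! this using 1
    rw [gaussianPDFReal]; ring
  have := integral_mul_deriv_eq_deriv_mul_of_integrable (u := u) (u' := u')
    (v := gaussianPDFReal 0 1) (v' := fun x => -(x * gaussianPDFReal 0 1 x))
    (fun x _ => h x) (fun x _ => hv x) 
    (by convert! h2.neg using 1; ext x; simp; ring) (by convert! h1 using 1) (by convert! h0 using 1)
  simp only [smul_eq_mul]
  calc _ = - ∫ x, u x * -(x * gaussianPDFReal 0 1 x) := by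
        rw [← integral_neg]; congr 1; ext x; ring
    _ = _ := by rw [this, neg_neg]; congr 1; ext x; ring

noncomputable abbrev gam (n : ℕ) : Measure (Fin n → ℝ) := Measure.pi fun _ : Fin n => gaussianReal 0 1

lemma steinN {n : ℕ} (i : Fin n) (u : (Fin n → ℝ) → ℝ) (h : Differentiable ℝ u)
    (h0 : Integrable u (gam n)) (h1 : Integrable (fun x => fderiv ℝ u x (Pi.single i 1)) (gam n))
    (h2 : Integrable (fun x => x i * u x) (gam n)) :
    ∫ x, x i * u x ∂(gam n) = ∫ x, fderiv ℝ u x (Pi.single i 1) ∂(gam n) := by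
  obtain _ | m := n
  · exact i.elim0
  have hp := (measurePreserving_piFinSuccAbove (fun _ : Fin (m+1) => gaussianReal 0 1) i).symm
  have hI : ∀ w : (Fin (m+1) → ℝ) → ℝ, Integrable w (gam (m+1)) → Integrable (fun p : ℝ × (Fin m → ℝ) => w (i.insertNth p.1 p.2)) ((gaussianReal 0 1).prod (gam m)) := by
    intro w hw
    exact (hp.integrable_comp_emb (MeasurableEquiv.measurableEmbedding _)).2 hw
  have hE : ∀ w : (Fin (m+1) → ℝ) → ℝ, Integrable w (gam (m+1)) → ∫ x, w x ∂(gam (m+1)) = ∫ y, ∫ t, w (i.insertNth t y) ∂(gaussianReal 0 1) ∂(gam m) := by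
    intro w hw
    rw [← integral_prod_symm _ (hI w hw)]
    exact (hp.integral_comp' w).symm
  rw [hE _ h1, hE _ h2]
  apply integral_congr_ae
  filter_upwards [(hI _ h0).prod_left_ae, (hI _ h1).prod_left_ae, (hI _ h2).prod_left_ae] with y a0 a1 a2
  simp only [Fin.insertNth_apply_same] at a2 ⊢
  apply stein1 _ _ _ a0 a1 a2
  intro t
  have hd : HasDerivAt (fun t : ℝ => (i.insertNth t y : Fin (m+1) → ℝ)) (Pi.single i 1) t := by
    rw [hasDerivAt_pi]
    intro j
    refine i.succAboveCases ?_ (fun k => ?_) j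
    · simpa using hasDerivAt_id' t
    · simpa using hasDerivAt_const t (y k)
  exact (h _).hasFDerivAt.comp_hasDerivAt t hd

lemma memLp_gam (n : ℕ) (p : ℕ) : MemLp (fun x : Fin n → ℝ => x) p (gam n) := by
  rw [memLp_pi_iff]
  intro i
  exact (memLp_id_gaussianReal' (p : ENNReal) (by simp)).comp_measurePreserving
    (measurePreserving_eval (fun _ : Fin n => gaussianReal 0 1) i)

lemma tg_integrable {n : ℕ} {u : (Fin n → ℝ) → ℝ} (h : u.HasTemperateGrowth) :
    Integrable u (gam n) := by
  obtain ⟨k, C, hC⟩ := h.2 0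
  have h1 : MemLp (fun x : Fin n → ℝ => 1 + ‖x‖) k (gam n) :=
    (memLp_const (1:ℝ)).add (memLp_gam n k).norm
  have h2 := (h1.integrable_norm_pow').const_mul C
  refine h2.mono' h.1.continuous.aestronglyMeasurable (Filter.Eventually.of_forall fun x => ?_)
  have := hC x
  rw [norm_iteratedFDeriv_zero] at this
  rwa [Real.norm_of_nonneg (by positivity : (0:ℝ) ≤ 1 + ‖x‖)]


lemma tg_fderiv {n : ℕ} {u : (Fin n → ℝ) → ℝ} (h : u.HasTemperateGrowth) (v : Fin n → ℝ) :
    Function.HasTemperateGrowth (fun x => fderiv ℝ u x v) := by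
  have h1 : Function.HasTemperateGrowth (fderiv ℝ u) := by
    refine ⟨h.1.fderiv_right (by simp), fun k => ?_⟩
    obtain ⟨m, C, hC⟩ := h.2 (k+1)
    refine ⟨m, C, fun x => ?_⟩
    rw [norm_iteratedFDeriv_fderiv]
    exact hC x
  exact (ContinuousLinearMap.apply ℝ ℝ v).hasTemperateGrowth.comp h1

/-- Functions of temperate growth. -/
def TG (n : ℕ) : Submodule ℝ ((Fin n → ℝ) → ℝ) where
  carrier := {u | u.HasTemperateGrowth}
  add_mem' := fun ha hb => Function.HasTemperateGrowth.add ha hb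
  zero_mem' := Function.HasTemperateGrowth.zero
  smul_mem' := fun c _ hu => Function.HasTemperateGrowth.smul (Function.HasTemperateGrowth.const c) hu

lemma tgOf {n : ℕ} (u : TG n) : Function.HasTemperateGrowth (u : (Fin n → ℝ) → ℝ) := u.2

lemma diffOf {n : ℕ} (u : TG n) : Differentiable ℝ (u : (Fin n → ℝ) → ℝ) :=
  u.2.1.differentiable (by simp)

lemma int_mul {n : ℕ} (u v : TG n) :
    Integrable (fun x => (u : (Fin n → ℝ) → ℝ) x * (v : (Fin n → ℝ) → ℝ) x) (gam n) :=
  tg_integrable ((tgOf u).mul (tgOf v))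

/-- Partial derivative. -/
noncomputable def dd {n : ℕ} (i : Fin n) : TG n →ₗ[ℝ] TG n where
  toFun u := ⟨fun x => fderiv ℝ (u : (Fin n → ℝ) → ℝ) x (Pi.single i 1), tg_fderiv u.2 _⟩
  map_add' u v := by
    ext x
    simp [fderiv_add ((diffOf u) x) ((diffOf v) x)]
  map_smul' c u := by
    ext x
    simp [fderiv_const_smul ((diffOf u) x)]

lemma tg_coord {n : ℕ} (i : Fin n) : Function.HasTemperateGrowth (fun x : Fin n → ℝ => x i) :=
  (ContinuousLinearMap.proj (R := ℝ) (φ := fun _ : Fin n => ℝ) i).hasTemperateGrowth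

/-- Adjoint of the partial derivative. -/
noncomputable def del {n : ℕ} (i : Fin n) : TG n →ₗ[ℝ] TG n where
  toFun u := ⟨fun x => x i * (u : (Fin n → ℝ) → ℝ) x - (dd i u : (Fin n → ℝ) → ℝ) x,
    ((tg_coord i).mul u.2).sub (dd i u).2⟩
  map_add' u v := by
    ext x
    simp
    ring
  map_smul' c u := by
    ext x
    simp
    ring

/-- The Gaussian inner product. -/
noncomputable def ip {n : ℕ} : TG n →ₗ[ℝ] TG n →ₗ[ℝ] ℝ :=
  LinearMap.mk₂ ℝ (fun u v => ∫ x, (u : (Fin n → ℝ) → ℝ) x * (v : (Fin n → ℝ) → ℝ) x ∂(gam n))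
    (fun u v w => by
      rw [← integral_add (int_mul u w) (int_mul v w)]
      simp [add_mul])
    (fun c u v => by
      rw [smul_eq_mul, ← integral_const_mul]
      simp [mul_assoc])
    (fun u v w => by
      rw [← integral_add (int_mul u v) (int_mul u w)]
      simp [mul_add])
    (fun c u v => by
      rw [smul_eq_mul, ← integral_const_mul]
      simp [mul_left_comm])

lemma ip_apply {n : ℕ} (u v : TG n) :
    ip u v = ∫ x, (u : (Fin n → ℝ) → ℝ) x * (v : (Fin n → ℝ) → ℝ) x ∂(gam n) := rfl

lemma ip_comm {n : ℕ} (u v : TG n) : ip u v = ip v u := by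
  simp only [ip_apply, mul_comm]

/-- The constant function one. -/
def tone (n : ℕ) : TG n := ⟨fun _ => 1, Function.HasTemperateGrowth.const 1⟩

lemma dd_tone {n : ℕ} (i : Fin n) : dd i (tone n) = 0 := by
  ext x
  simp [dd, tone]

lemma ip_tone_tone (n : ℕ) : ip (tone n) (tone n) = 1 := by
  simp [ip_apply, tone]

lemma ip_del {n : ℕ} (i : Fin n) (u v : TG n) : ip u (del i v) = ip (dd i u) v := by
  have hg := (tgOf u).mul (tgOf v)
  have h := steinN i _ ((diffOf u).mul (diffOf v)) (tg_integrable hg) (tg_integrable (tg_fderiv hg _))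
    (tg_integrable ((tg_coord i).mul hg))
  have e : ∀ x, fderiv ℝ ((u : (Fin n → ℝ) → ℝ) * (v : (Fin n → ℝ) → ℝ)) x (Pi.single i 1) =
      (dd i u : (Fin n → ℝ) → ℝ) x * (v : (Fin n → ℝ) → ℝ) x +
      (u : (Fin n → ℝ) → ℝ) x * (dd i v : (Fin n → ℝ) → ℝ) x := by
    intro x
    rw [fderiv_mul ((diffOf u) x) ((diffOf v) x)]
    simp [dd]
    ring
  simp only [e] at h
  have hI : Integrable (fun x => x i * ((u : (Fin n → ℝ) → ℝ) * (v : (Fin n → ℝ) → ℝ)) x) (gam n) :=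
    tg_integrable ((tg_coord i).mul hg)
  rw [integral_add (int_mul (dd i u) v)
    (int_mul u (dd i v))] at h
  rw [ip_apply, ip_apply, eq_sub_of_add_eq h.symm,
    ← integral_sub hI (int_mul u (dd i v))]
  congr 1
  ext x
  simp [del]
  ring

lemma dd_comm {n : ℕ} (i j : Fin n) (u : TG n) : dd i (dd j u) = dd j (dd i u) := by
  ext x
  have h2 : Differentiable ℝ (fderiv ℝ (u : (Fin n → ℝ) → ℝ)) :=
    (u.2.1.fderiv_right (m := 1) (by norm_cast)).differentiable (by simp)
  have hs : IsSymmSndFDerivAt ℝ (u : (Fin n → ℝ) → ℝ) x :=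
    (u.2.1.contDiffAt).isSymmSndFDerivAt (by simp; norm_cast)
  have e : ∀ v w : Fin n → ℝ, fderiv ℝ (fun y => fderiv ℝ (u : (Fin n → ℝ) → ℝ) y v) x w
      = fderiv ℝ (fderiv ℝ (u : (Fin n → ℝ) → ℝ)) x w v := by
    intro v w
    rw [fderiv_clm_apply (h2 x) (differentiableAt_const v)]
    simp
  change fderiv ℝ (fun y => fderiv ℝ (u : (Fin n → ℝ) → ℝ) y _) x _ =
    fderiv ℝ (fun y => fderiv ℝ (u : (Fin n → ℝ) → ℝ) y _) x _
  rw [e, e]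
  exact hs _ _

lemma dd_del {n : ℕ} (i j : Fin n) (u : TG n) :
    dd i (del j u) = del j (dd i u) + (if i = j then (1:ℝ) else 0) • u := by
  ext x
  have h := congrArg (fun w : TG n => (w : (Fin n → ℝ) → ℝ) x) (dd_comm i j u)
  have hc : HasFDerivAt (fun x : Fin n → ℝ => x j)
    (ContinuousLinearMap.proj (R := ℝ) (φ := fun _ : Fin n => ℝ) j) x :=
    (ContinuousLinearMap.proj (R := ℝ) (φ := fun _ : Fin n => ℝ) j).hasFDerivAt
  have h1 := (hc.mul ((diffOf u) x).hasFDerivAt).sub ((diffOf (dd j u)) x).hasFDerivAt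
  have h2 : (dd i (del j u) : (Fin n → ℝ) → ℝ) x = _ :=
    congrArg (fun L => L (Pi.single i 1)) h1.fderiv
  rw [h2]
  change (dd i (dd j u) : (Fin n → ℝ) → ℝ) x = _ at h
  have h3 : fderiv ℝ (dd j u : (Fin n → ℝ) → ℝ) x (Pi.single i 1) =
    (dd j (dd i u) : (Fin n → ℝ) → ℝ) x := h
  simp only [_root_.sub_apply, _root_.add_apply,
    _root_.smul_apply, h3]
  by_cases hij : i = j
  · subst hij
    simp [del, dd]
    ring
  · simp [del, dd, hij, Ne.symm hij]

/-- The Hermite polynomials of order four with paired indices. -/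
noncomputable def herm {n : ℕ} (i j : Fin n) : TG n := del j (del j (del i (del i (tone n))))

lemma ip_herm {n : ℕ} (i j : Fin n) (u : TG n) :
    ip u (herm i j) = ip (dd i (dd i (dd j (dd j u)))) (tone n) := by
  simp [herm, ip_del]

lemma ip_herm_herm {n : ℕ} (i j k l : Fin n) :
    ip (herm i j) (herm k l) = 4 * (if i = k ∧ j = l then 1 else 0)
      + 4 * (if i = l ∧ j = k then 1 else 0) + 16 * (if i = k ∧ j = l ∧ i = j then 1 else 0) := by
  rw [ip_herm, herm]
  simp only [dd_del, dd_tone, map_add, map_smul, map_zero, LinearMap.add_apply,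
    LinearMap.smul_apply, ip_tone_tone, zero_add, smul_eq_mul]
  by_cases h1 : i = k <;> by_cases h2 : j = l <;> by_cases h3 : i = l <;> by_cases h4 : j = k <;>
    by_cases h5 : i = j <;> simp_all <;> grind

theorem fourth_deriv_sum_le_variance (n : ℕ) (f : (Fin n → ℝ) → ℝ)
    (hf : ContDiff ℝ (⊤ : ℕ∞) f)
    (hbd : ∀ k : ℕ, ∃ C : ℝ, ∀ x, ‖iteratedFDeriv ℝ k f x‖ ≤ C) :
    ∑ i : Fin n, ∑ j : Fin n,
        (∫ x, iteratedFDeriv ℝ 4 f x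
            (fun m : Fin 4 => Pi.single (if (m : ℕ) < 2 then i else j) 1)
            ∂(Measure.pi fun _ : Fin n => gaussianReal 0 1)) ^ 2
      ≤ (Nat.factorial 4 : ℝ) *
          variance f (Measure.pi fun _ : Fin n => gaussianReal 0 1) := by
  have htg : f.HasTemperateGrowth := by
    refine ⟨hf, fun k => ?_⟩
    obtain ⟨C, hC⟩ := hbd k
    exact ⟨0, C, fun x => by simpa using hC x⟩
  let F : TG n := ⟨f, htg⟩
  have hit : ∀ (i j : Fin n) (x : Fin n → ℝ), iteratedFDeriv ℝ 4 f x
      (fun m : Fin 4 => Pi.single (if (m : ℕ) < 2 then i else j) 1) =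
      (dd i (dd i (dd j (dd j F))) : (Fin n → ℝ) → ℝ) x := by
    have step : ∀ (k : ℕ) (v : Fin (k+1) → (Fin n → ℝ)) (x : Fin n → ℝ),
        iteratedFDeriv ℝ (k+1) f x v =
        fderiv ℝ (fun y => iteratedFDeriv ℝ k f y (Fin.tail v)) x (v 0) := by
      intro k v x
      rw [iteratedFDeriv_succ_apply_left]
      have hd : DifferentiableAt ℝ (iteratedFDeriv ℝ k f) x :=
        (hf.differentiable_iteratedFDeriv (m := k) (by exact_mod_cast WithTop.coe_lt_top _)) x
      rw [fderiv_continuousMultilinear_apply_const_apply hd]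
    intro i j x
    simp only [step, iteratedFDeriv_zero_apply, Fin.tail]
    rfl
  set a : Fin n → Fin n → ℝ := fun i j => ∫ x, iteratedFDeriv ℝ 4 f x
      (fun m : Fin 4 => Pi.single (if (m : ℕ) < 2 then i else j) 1) ∂(gam n) with ha
  have haF : ∀ i j, ip F (herm i j) = a i j := by
    intro i j
    rw [ip_herm, ip_apply, ha]
    simp only [hit, tone, mul_one]
  set S := ∑ i, ∑ j, a i j ^ 2 with hS
  let G : TG n := ∑ i, ∑ j, a i j • herm i j
  have hFG : ip F G = S := by
    simp only [G, map_sum, map_smul, haF, hS, smul_eq_mul, sq]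
  have h1G : ip (tone n) G = 0 := by
    simp [G, map_sum, ip_herm, dd_tone]
  have hGG : ip G G ≤ 24 * S := by
    have e : ip G G = ∑ i, ∑ j, (4 * a i j ^ 2 + 4 * (a i j * a j i)
        + 16 * (if i = j then a i j ^ 2 else 0)) := by
      have : ∀ k l, ip G (herm k l) = 4 * a k l + 4 * a l k + 16 * (if k = l then a k l else 0) := by
        intro k l
        simp only [G, map_sum, map_smul, LinearMap.sum_apply, LinearMap.smul_apply, ip_herm_herm,
          smul_eq_mul, mul_add, Finset.sum_add_distrib]
        congr 1
        · congr 1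
          · simp [ite_and, mul_comm]
          · simp [ite_and, mul_comm]
        · simp [ite_and, mul_comm]
      change ip G (∑ i, ∑ j, a i j • herm i j) = _
      simp only [map_sum, map_smul, this, smul_eq_mul]
      refine Finset.sum_congr rfl fun i _ => Finset.sum_congr rfl fun j _ => ?_
      split_ifs <;> ring
    rw [e]
    have hsw : ∑ i, ∑ j, a j i ^ 2 = S := Finset.sum_comm
    have hle : ∑ i, ∑ j, (4 * a i j ^ 2 + 4 * (a i j * a j i)
        + 16 * (if i = j then a i j ^ 2 else 0)) ≤ ∑ i, ∑ j, (22 * a i j ^ 2 + 2 * a j i ^ 2) := by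
      refine Finset.sum_le_sum fun i _ => Finset.sum_le_sum fun j _ => ?_
      split_ifs <;> nlinarith [sq_nonneg (a i j - a j i), sq_nonneg (a i j)]
    refine hle.trans (le_of_eq ?_)
    simp only [Finset.sum_add_distrib, ← Finset.mul_sum, hsw]
    rw [← hS]
    ring
  have hvar : variance f (gam n) = ip (F - ip F (tone n) • tone n) (F - ip F (tone n) • tone n) := by
    rw [variance_eq_integral htg.1.continuous.aemeasurable, ip_apply]
    have : ip F (tone n) = ∫ x, f x ∂(gam n) := by simp [ip_apply, tone, F]
    rw [this]
    simp [tone, F, sq]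
  set m := ip F (tone n)
  have hpos : 0 ≤ ip (F - m • tone n - (1/24:ℝ) • G) (F - m • tone n - (1/24:ℝ) • G) := by
    rw [ip_apply]
    exact integral_nonneg fun x => mul_self_nonneg _
  set H := F - m • tone n with hH
  have hHG : ip H G = S := by simp [hH, hFG, h1G]
  have hGH : ip G H = S := by rw [ip_comm, hHG]
  simp only [map_sub, LinearMap.sub_apply, map_smul, LinearMap.smul_apply, smul_eq_mul, hHG, hGH,
    ← hvar] at hpos
  change S ≤ (Nat.factorial 4 : ℝ) * variance f (gam n)
  have : ((Nat.factorial 4 : ℕ) : ℝ) = 24 := by norm_num [Nat.factorial]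
  rw [this]
  linarith
end

section
/- Let ψ(g) = (1/N) log Σ_{σ} μ(σ) exp(γ Σ_{α} g_α f_α(σ)) and let H(σ) = (1/N) Σ_α g_α f_α(σ). Then E⟨H²⟩ − E[⟨H⟩²] = (1/(N γ²)) Σ_{α,α'} E[∂⁴ψ/∂g_α²∂g_{α'}²] + (1/N²) Σ_α E[⟨f_α²⟩ − ⟨f_α⟩²]. -/
open MeasureTheory ProbabilityTheory
open scoped ContDiff

set_option linter.unusedSectionVars false

namespace GibbsVar

lemma gauss_integrable_iff {u : ℝ → ℝ} :
    Integrable u (gaussianReal 0 1) ↔ Integrable (fun x => gaussianPDFReal 0 1 x * u x) := by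
  rw [gaussianReal_of_var_ne_zero 0 one_ne_zero,
    integrable_withDensity_iff_integrable_smul' (measurable_gaussianPDF 0 1)
      (Filter.Eventually.of_forall fun _ => gaussianPDF_lt_top)]
  simp [toReal_gaussianPDF]

lemma gauss_hasDerivAt (x : ℝ) :
    HasDerivAt (gaussianPDFReal 0 1) (-(x * gaussianPDFReal 0 1 x)) x := by
  rw [gaussianPDFReal_def]
  have h : HasDerivAt (fun x : ℝ => -(x - 0) ^ 2 / (2 * ((1 : NNReal) : ℝ))) (-x) x := by
    have := (((hasDerivAt_id x).sub_const 0).pow 2).neg.div_const (2 * ((1 : NNReal) : ℝ))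
    convert! this using 1
    simp
    ring
  convert! h.exp.const_mul ((√(2 * Real.pi * ((1 : NNReal) : ℝ)))⁻¹) using 1
  ring

lemma stein_one {u u' : ℝ → ℝ} (hu : ∀ x, HasDerivAt u (u' x) x)
    (h0 : Integrable u (gaussianReal 0 1)) (h1 : Integrable u' (gaussianReal 0 1))
    (h2 : Integrable (fun x => x * u x) (gaussianReal 0 1)) :
    ∫ x, x * u x ∂(gaussianReal 0 1) = ∫ x, u' x ∂(gaussianReal 0 1) := by
  have key := integral_eq_zero_of_hasDerivAt_of_integrable
    (f := fun x => gaussianPDFReal 0 1 x * u x)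
    (f' := fun x => gaussianPDFReal 0 1 x * (u' x - x * u x))
    (fun x => by
      convert! (gauss_hasDerivAt x).mul (hu x) using 1
      ring)
    (gauss_integrable_iff.1 (h1.sub h2)) (gauss_integrable_iff.1 h0)
  have h3 : ∫ x, (u' x - x * u x) ∂(gaussianReal 0 1) = 0 := by
    rw [integral_gaussianReal_eq_integral_smul one_ne_zero]
    simpa using key
  rw [integral_sub h1 h2] at h3
  linarith

variable {ι : Type*} [Fintype ι] [DecidableEq ι]

/-- Standard Gaussian measure. -/
noncomputable abbrev gP (ι : Type*) [Fintype ι] : Measure (ι → ℝ) :=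
  Measure.pi fun _ : ι => gaussianReal 0 1

lemma mp_update (α : ι) :
    MeasurePreserving (fun p : (ι → ℝ) × ℝ => Function.update p.1 α p.2)
      ((gP ι).prod (gaussianReal 0 1)) (gP ι) := by
  have hm : Measurable (fun p : (ι → ℝ) × ℝ => Function.update p.1 α p.2) := by
    rw [measurable_pi_iff]
    intro i
    by_cases h : i = α
    · subst h; simpa using measurable_snd
    · simp only [Function.update_of_ne h]
      exact (measurable_pi_apply i).comp measurable_fst
  refine ⟨hm, ?_⟩
  symm
  apply Measure.pi_eq
  intro s hs
  rw [Measure.map_apply hm (MeasurableSet.univ_pi hs)]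
  have : (fun p : (ι → ℝ) × ℝ => Function.update p.1 α p.2) ⁻¹' (Set.univ.pi s)
      = (Set.univ.pi (Function.update s α Set.univ)) ×ˢ (s α) := by
    ext p
    simp only [Set.mem_preimage, Set.mem_univ_pi, Set.mem_prod]
    constructor
    · intro h
      refine ⟨fun i => ?_, by simpa using h α⟩
      by_cases hi : i = α
      · subst hi; simp
      · simpa [Function.update_of_ne hi] using h i
    · rintro ⟨h, h'⟩ i
      by_cases hi : i = α
      · subst hi; simpa using h'
      · simpa [Function.update_of_ne hi] using h i
  rw [this, Measure.prod_prod, Measure.pi_pi, ← Finset.mul_prod_erase _ _ (Finset.mem_univ α),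
    ← Finset.mul_prod_erase Finset.univ (fun i => gaussianReal 0 1 (s i)) (Finset.mem_univ α)]
  simp only [Function.update_self, measure_univ, one_mul]
  rw [mul_comm]
  congr 1
  apply Finset.prod_congr rfl
  intro i hi
  rw [Function.update_of_ne (Finset.ne_of_mem_erase hi)]

/-- partial derivative -/
noncomputable def d (α : ι) (φ : (ι → ℝ) → ℝ) : (ι → ℝ) → ℝ :=
  fun g => fderiv ℝ φ g (Pi.single α 1)

lemma stein (α : ι) {φ : (ι → ℝ) → ℝ} (hφ : Differentiable ℝ φ)
    (h0 : Integrable φ (gP ι)) (h1 : Integrable (d α φ) (gP ι))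
    (h2 : Integrable (fun g => g α * φ g) (gP ι)) :
    ∫ g, g α * φ g ∂(gP ι) = ∫ g, d α φ g ∂(gP ι) := by
  have mp := mp_update α
  have tr : ∀ {θ : (ι → ℝ) → ℝ}, Integrable θ (gP ι) →
      ∫ g, θ g ∂(gP ι) = ∫ g, ∫ t, θ (Function.update g α t) ∂(gaussianReal 0 1) ∂(gP ι) := by
    intro θ hθ
    have hi := mp.integrable_comp_of_integrable hθ
    conv_lhs => rw [← mp.map_eq]
    rw [integral_map mp.measurable.aemeasurable (by rw [mp.map_eq]; exact hθ.1)]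
    exact integral_prod _ hi
  rw [tr h1, tr h2]
  apply integral_congr_ae
  filter_upwards [(mp.integrable_comp_of_integrable h0).prod_right_ae,
    (mp.integrable_comp_of_integrable h1).prod_right_ae,
    (mp.integrable_comp_of_integrable h2).prod_right_ae] with g a0 a1 a2
  simp only [Function.comp_def, Function.update_self] at a0 a1 a2 ⊢
  refine stein_one (fun x => ?_) a0 a1 a2
  exact (hφ (Function.update g α x)).hasFDerivAt.comp_hasDerivAt x (hasDerivAt_update g α x)

lemma memLp_coord (α : ι) : MemLp (fun g : ι → ℝ => g α) 2 (gP ι) :=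
  (memLp_id_gaussianReal' 2 (by simp)).comp_measurePreserving
    (measurePreserving_eval (fun _ : ι => gaussianReal 0 1) α)

lemma int_coord (α : ι) : Integrable (fun g : ι → ℝ => g α) (gP ι) :=
  (memLp_coord α).integrable (by norm_num)

lemma int_coord2 (α β : ι) : Integrable (fun g : ι → ℝ => g α * g β) (gP ι) :=
  (memLp_coord α).integrable_mul (memLp_coord β)

/-- bounded, analytic. -/
structure Good (φ : (ι → ℝ) → ℝ) : Prop where
  smooth : ContDiff ℝ ω φ
  bdd : ∃ C, ∀ g, |φ g| ≤ C

lemma Good.int_mul {φ : (ι → ℝ) → ℝ} (h : Good φ) {θ : (ι → ℝ) → ℝ} (hθ : Integrable θ (gP ι)) :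
    Integrable (fun g => θ g * φ g) (gP ι) := by
  obtain ⟨C, hC⟩ := h.bdd
  exact hθ.mul_bdd (c := C) h.smooth.continuous.aestronglyMeasurable
    (Filter.Eventually.of_forall hC)

lemma Good.int {φ : (ι → ℝ) → ℝ} (h : Good φ) : Integrable φ (gP ι) := by
  simpa using h.int_mul (integrable_const (1 : ℝ))

lemma stein_two (α β : ι) {φ : (ι → ℝ) → ℝ} (h : Good φ) (h1 : Good (d α φ))
    (h2 : Good (d β (d α φ))) :
    ∫ g, g α * g β * φ g ∂(gP ι) =
      (if α = β then ∫ g, φ g ∂(gP ι) else 0) + ∫ g, d β (d α φ) g ∂(gP ι) := by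
  have hd : Differentiable ℝ φ := h.smooth.differentiable (by simp)
  have e : d α (fun g => g β * φ g) = fun g => (if α = β then φ g else 0) + g β * d α φ g := by
    funext g
    have : HasFDerivAt (fun g : ι → ℝ => g β * φ g) _ g :=
      (hasFDerivAt_apply (𝕜 := ℝ) β g).mul (hd g).hasFDerivAt
    simp only [d, this.fderiv]
    by_cases hab : α = β
    · subst hab; simp; ring
    · simp [hab, Ne.symm hab]
  have i1 : Integrable (fun g => (if α = β then φ g else 0)) (gP ι) := by
    split_ifs
    · exact h.int
    · simp
  have i2 := h1.int_mul (int_coord β)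
  have := stein α (φ := fun g => g β * φ g) ((differentiable_apply β).mul hd)
    (h.int_mul (int_coord β)) (by rw [e]; exact i1.add i2)
    (by simpa only [mul_assoc] using h.int_mul (int_coord2 α β))
  simp only [mul_assoc]
  rw [this, e, integral_add i1 i2, stein β (h1.smooth.differentiable (by simp)) h1.int h2.int i2]
  congr 1
  split_ifs <;> simp

lemma d_smooth (α : ι) {φ : (ι → ℝ) → ℝ} (h : ContDiff ℝ ω φ) : ContDiff ℝ ω (d α φ) := by
  unfold d
  exact (h.fderiv_right (m := ω) (by simp)).clm_apply contDiff_const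

lemma d_const_mul (α : ι) {φ : (ι → ℝ) → ℝ} (h : ContDiff ℝ ω φ) (c : ℝ) :
    d α (fun g => c * φ g) = fun g => c * d α φ g := by
  funext g
  have hd := h.differentiable (by simp)
  have : HasFDerivAt (fun g => c * φ g) _ g := (hd g).hasFDerivAt.const_mul c
  simp [d, this.fderiv]

lemma d_mul (α : ι) {φ θ : (ι → ℝ) → ℝ} (h : ContDiff ℝ ω φ) (h' : ContDiff ℝ ω θ) :
    d α (fun g => φ g * θ g) = fun g => d α φ g * θ g + φ g * d α θ g := by
  funext g
  have hd := h.differentiable (by simp)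
  have hd' := h'.differentiable (by simp)
  have : HasFDerivAt (fun g => φ g * θ g) _ g := (hd g).hasFDerivAt.mul (hd' g).hasFDerivAt
  simp [d, this.fderiv]
  ring

lemma d_sub (α : ι) {φ θ : (ι → ℝ) → ℝ} (h : ContDiff ℝ ω φ) (h' : ContDiff ℝ ω θ) :
    d α (fun g => φ g - θ g) = fun g => d α φ g - d α θ g := by
  funext g
  have hd := h.differentiable (by simp)
  have hd' := h'.differentiable (by simp)
  have : HasFDerivAt (fun g => φ g - θ g) _ g := (hd g).hasFDerivAt.sub (hd' g).hasFDerivAt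
  simp [d, this.fderiv]

lemma iter_succ {φ : (ι → ℝ) → ℝ} (h : ContDiff ℝ ω φ) {n : ℕ} (v : Fin (n + 1) → ι)
    (g : ι → ℝ) :
    iteratedFDeriv ℝ (n + 1) φ g (fun m => Pi.single (v m) 1) =
      d (v 0) (fun y => iteratedFDeriv ℝ n φ y (fun m => Pi.single (v m.succ) 1)) g := by
  rw [DifferentiableAt.iteratedFDeriv_succ_apply_left']
  · rfl
  · exact (h.differentiable_iteratedFDeriv (by simp)) g

lemma iter_four {φ : (ι → ℝ) → ℝ} (h : ContDiff ℝ ω φ) (v : Fin 4 → ι) (g : ι → ℝ) :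
    iteratedFDeriv ℝ 4 φ g (fun m => Pi.single (v m) 1) =
      d (v 0) (d (v 1) (d (v 2) (d (v 3) φ))) g := by
  rw [iter_succ h]
  simp_rw [iter_succ h]
  simp only [iteratedFDeriv_zero_apply]
  rfl

lemma sq_sum (c : ℝ) (x : ι → ℝ) :
    ((1 / c) * ∑ i, x i) ^ 2 = ∑ i, ∑ j, (1 / c ^ 2) * (x i * x j) := by
  simp_rw [← Finset.mul_sum]
  rw [← Finset.sum_mul]
  ring

section Gibbs

variable {S : Type*} [Fintype S] (μ : S → ℝ) (f : ι → S → ℝ) (γ : ℝ)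

/-- Boltzmann weight -/
noncomputable def w (g : ι → ℝ) (σ : S) : ℝ := μ σ * Real.exp (γ * ∑ α, g α * f α σ)

/-- unnormalised average -/
noncomputable def U (h : S → ℝ) (g : ι → ℝ) : ℝ := ∑ σ, w μ f γ g σ * h σ

/-- partition function -/
noncomputable def Z (g : ι → ℝ) : ℝ := ∑ σ, w μ f γ g σ

/-- Gibbs average -/
noncomputable def A (h : S → ℝ) (g : ι → ℝ) : ℝ := U μ f γ h g / Z μ f γ g

lemma w_smooth (σ : S) : ContDiff ℝ ω (fun g => w μ f γ g σ) := by
  unfold w; fun_prop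

lemma U_smooth (h : S → ℝ) : ContDiff ℝ ω (U μ f γ h) := by
  unfold U
  exact ContDiff.sum fun σ _ => (w_smooth μ f γ σ).mul contDiff_const

lemma Z_eq : Z μ f γ = U μ f γ (fun _ => 1) := by
  funext g; simp [Z, U]

lemma Z_smooth : ContDiff ℝ ω (Z μ f γ) := by
  rw [Z_eq]; exact U_smooth ..

lemma d_U (α : ι) (h : S → ℝ) :
    d α (U μ f γ h) = fun g => γ * U μ f γ (fun σ => f α σ * h σ) g := by
  funext g
  have hL : ∀ σ, HasFDerivAt (fun g : ι → ℝ => ∑ α, g α * f α σ)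
      (∑ α, f α σ • (ContinuousLinearMap.proj α : (ι → ℝ) →L[ℝ] ℝ)) g := fun σ =>
    HasFDerivAt.fun_sum fun β _ => (hasFDerivAt_apply (𝕜 := ℝ) β g).mul_const (f β σ)
  have : HasFDerivAt (U μ f γ h) _ g := HasFDerivAt.fun_sum (u := Finset.univ) fun σ _ =>
    ((((hL σ).const_mul γ).exp).const_mul (μ σ)).mul_const (h σ)
  simp only [d, this.fderiv, U, w, _root_.sum_apply, _root_.smul_apply,
    ContinuousLinearMap.proj_apply, smul_eq_mul, Finset.mul_sum, Pi.single_apply]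
  apply Finset.sum_congr rfl
  intro σ _
  simp
  ring

variable {μ}

lemma w_nonneg (hμ0 : ∀ σ, 0 ≤ μ σ) (g : ι → ℝ) (σ : S) : 0 ≤ w μ f γ g σ :=
  mul_nonneg (hμ0 σ) (Real.exp_pos _).le

lemma Z_pos (hμ0 : ∀ σ, 0 ≤ μ σ) (hμ1 : ∑ σ, μ σ = 1)
    (g : ι → ℝ) : 0 < Z μ f γ g := by
  have : ∃ σ ∈ Finset.univ, 0 < μ σ := by
    apply Finset.exists_lt_of_sum_lt (f := fun _ => (0 : ℝ))
    simp [hμ1]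
  obtain ⟨σ, _, hσ⟩ := this
  exact Finset.sum_pos' (fun σ _ => w_nonneg f γ hμ0 g σ)
    ⟨σ, Finset.mem_univ _, mul_pos hσ (Real.exp_pos _)⟩

lemma A_smooth (hμ0 : ∀ σ, 0 ≤ μ σ) (hμ1 : ∑ σ, μ σ = 1)
    (h : S → ℝ) : ContDiff ℝ ω (A μ f γ h) :=
  (U_smooth μ f γ h).div (Z_smooth μ f γ) fun g => (Z_pos f γ hμ0 hμ1 g).ne'

lemma d_A (hμ0 : ∀ σ, 0 ≤ μ σ) (hμ1 : ∑ σ, μ σ = 1)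
    (α : ι) (h : S → ℝ) :
    d α (A μ f γ h) = fun g => γ * (A μ f γ (fun σ => f α σ * h σ) g
      - A μ f γ (f α) g * A μ f γ h g) := by
  have e : (fun g => A μ f γ h g * Z μ f γ g) = U μ f γ h := by
    funext g
    exact div_mul_cancel₀ _ (Z_pos f γ hμ0 hμ1 g).ne'
  have e2 := d_mul α (A_smooth f γ hμ0 hμ1 h) (Z_smooth μ f γ)
  have e3 : d α (Z μ f γ) = fun g => γ * U μ f γ (f α) g := by
    rw [Z_eq, d_U]; simp
  rw [e, d_U, e3] at e2
  funext g
  have hz := (Z_pos f γ hμ0 hμ1 g).ne'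
  have e4 := congrFun e2 g
  simp only at e4
  rw [← mul_left_inj' hz, ← sub_eq_iff_eq_add.2 e4]
  simp only [A]
  field_simp

lemma A_good (hμ0 : ∀ σ, 0 ≤ μ σ) (hμ1 : ∑ σ, μ σ = 1)
    (h : S → ℝ) : Good (A μ f γ h) := by
  refine ⟨A_smooth f γ hμ0 hμ1 h, ∑ σ, |h σ|, fun g => ?_⟩
  have hz := Z_pos f γ hμ0 hμ1 g
  rw [A, abs_div, abs_of_pos hz, div_le_iff₀ hz, U, Z, Finset.mul_sum]
  refine (Finset.abs_sum_le_sum_abs _ _).trans (Finset.sum_le_sum fun σ _ => ?_)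
  rw [abs_mul, abs_of_nonneg (w_nonneg f γ hμ0 g σ), mul_comm]
  exact mul_le_mul_of_nonneg_right
    (Finset.single_le_sum (f := fun σ => |h σ|) (fun _ _ => abs_nonneg _) (Finset.mem_univ σ))
    (w_nonneg f γ hμ0 g σ)

variable (μ) in
/-- polynomials in Gibbs averages -/
inductive GPoly : ((ι → ℝ) → ℝ) → Prop
  | avg (h : S → ℝ) : GPoly (A μ f γ h)
  | mul {φ θ} : GPoly φ → GPoly θ → GPoly (fun g => φ g * θ g)
  | sub {φ θ} : GPoly φ → GPoly θ → GPoly (fun g => φ g - θ g)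
  | smul (c : ℝ) {φ} : GPoly φ → GPoly (fun g => c * φ g)

lemma GPoly.good (hμ0 : ∀ σ, 0 ≤ μ σ) (hμ1 : ∑ σ, μ σ = 1)
    {φ : (ι → ℝ) → ℝ} (h : GPoly μ f γ φ) : Good φ := by
  induction h with
  | avg h => exact A_good f γ hμ0 hμ1 h
  | mul _ _ h1 h2 =>
    obtain ⟨C, hC⟩ := h1.bdd
    obtain ⟨D, hD⟩ := h2.bdd
    refine ⟨h1.smooth.mul h2.smooth, C * D, fun g => ?_⟩
    rw [abs_mul]
    exact mul_le_mul (hC g) (hD g) (abs_nonneg _) ((abs_nonneg _).trans (hC g))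
  | sub _ _ h1 h2 =>
    obtain ⟨C, hC⟩ := h1.bdd
    obtain ⟨D, hD⟩ := h2.bdd
    exact ⟨h1.smooth.sub h2.smooth, C + D,
      fun g => (abs_sub _ _).trans (add_le_add (hC g) (hD g))⟩
  | smul c _ h1 =>
    obtain ⟨C, hC⟩ := h1.bdd
    refine ⟨contDiff_const.mul h1.smooth, |c| * C, fun g => ?_⟩
    rw [abs_mul]
    exact mul_le_mul_of_nonneg_left (hC g) (abs_nonneg _)

lemma GPoly.d (hμ0 : ∀ σ, 0 ≤ μ σ) (hμ1 : ∑ σ, μ σ = 1)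
    {φ : (ι → ℝ) → ℝ} (h : GPoly μ f γ φ) (α : ι) : GPoly μ f γ (d α φ) := by
  induction h with
  | avg h =>
    rw [d_A f γ hμ0 hμ1]
    exact .smul _ (.sub (.avg _) (.mul (.avg _) (.avg _)))
  | @mul φ θ p1 p2 h1 h2 =>
    rw [d_mul α (p1.good f γ hμ0 hμ1).smooth (p2.good f γ hμ0 hμ1).smooth]
    have := GPoly.sub (.mul h1 p2) (.smul (-1) (.mul p1 h2))
    convert! this using 2
    ring
  | sub p1 p2 h1 h2 =>
    rw [d_sub α (p1.good f γ hμ0 hμ1).smooth (p2.good f γ hμ0 hμ1).smooth]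
    exact .sub h1 h2
  | smul c p1 h1 =>
    rw [d_const_mul α (p1.good f γ hμ0 hμ1).smooth]
    exact .smul c h1

variable (μ) in
/-- covariance -/
noncomputable def V (α β : ι) (g : ι → ℝ) : ℝ :=
  A μ f γ (fun σ => f α σ * f β σ) g - A μ f γ (f α) g * A μ f γ (f β) g

lemma V_poly (α β : ι) : GPoly μ f γ (V μ f γ α β) :=
  .sub (.avg _) (.mul (.avg _) (.avg _))

variable (μ) in
/-- free energy -/
noncomputable def psi (N : ℝ) (g : ι → ℝ) : ℝ := (1 / N) * Real.log (Z μ f γ g)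

lemma psi_smooth (hμ0 : ∀ σ, 0 ≤ μ σ) (hμ1 : ∑ σ, μ σ = 1)
    (N : ℝ) : ContDiff ℝ ω (psi μ f γ N) :=
  contDiff_const.mul ((Z_smooth μ f γ).log fun g => (Z_pos f γ hμ0 hμ1 g).ne')

lemma d_psi (hμ0 : ∀ σ, 0 ≤ μ σ) (hμ1 : ∑ σ, μ σ = 1)
    (N : ℝ) (β : ι) : d β (psi μ f γ N) = fun g => (γ / N) * A μ f γ (f β) g := by
  funext g
  have hz := (Z_pos f γ hμ0 hμ1 g).ne'
  have e3 : d β (Z μ f γ) g = γ * U μ f γ (f β) g := by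
    rw [Z_eq, d_U]; simp
  have hd : DifferentiableAt ℝ (Z μ f γ) g := (Z_smooth μ f γ).differentiable (by simp) g
  have : HasFDerivAt (psi μ f γ N) _ g := (hd.hasFDerivAt.log hz).const_mul (1 / N)
  rw [d] at e3
  simp only [d, this.fderiv, _root_.smul_apply, e3, smul_eq_mul, A]
  ring

lemma d_d_psi (hμ0 : ∀ σ, 0 ≤ μ σ) (hμ1 : ∑ σ, μ σ = 1)
    (N : ℝ) (α β : ι) :
    d α (d β (psi μ f γ N)) = fun g => (γ ^ 2 / N) * V μ f γ α β g := by
  rw [d_psi f γ hμ0 hμ1, d_const_mul α (A_smooth f γ hμ0 hμ1 _), d_A f γ hμ0 hμ1]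
  funext g
  simp only [V]
  ring

lemma d4_psi (hμ0 : ∀ σ, 0 ≤ μ σ) (hμ1 : ∑ σ, μ σ = 1)
    (N : ℝ) (α β : ι) (g : ι → ℝ) :
    iteratedFDeriv ℝ 4 (psi μ f γ N) g
        (fun m : Fin 4 => Pi.single (if (m : ℕ) < 2 then α else β) 1)
      = (γ ^ 2 / N) * d β (d α (V μ f γ α β)) g := by
  have hs := psi_smooth f γ hμ0 hμ1 N
  have hv := ((V_poly (μ := μ) f γ α β).good f γ hμ0 hμ1).smooth
  have h1 := iter_four hs (![β, α, α, β]) g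
  have h2 := hs.contDiffAt.iteratedFDeriv_comp_perm (x := g)
    (fun m : Fin 4 => (Pi.single (if (m : ℕ) < 2 then α else β) 1 : ι → ℝ)) (Equiv.swap 0 2)
  rw [← h2]
  have h3 : ((fun m : Fin 4 => (Pi.single (if (m : ℕ) < 2 then α else β) 1 : ι → ℝ)) ∘
      (Equiv.swap (0 : Fin 4) 2)) = fun m => Pi.single ((![β, α, α, β] : Fin 4 → ι) m) 1 := by
    funext m
    fin_cases m <;> simp [Equiv.swap_apply_def]
  rw [h3, h1]
  simp only [Matrix.cons_val]
  rw [d_d_psi f γ hμ0 hμ1, d_const_mul α hv, d_const_mul β (d_smooth α hv)]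

theorem main (hμ0 : ∀ σ, 0 ≤ μ σ) (hμ1 : ∑ σ, μ σ = 1)
    (hγ : γ ≠ 0) (N : ℝ) (hN : 0 < N) :
    (∫ g, A μ f γ (fun σ => ((1 / N) * ∑ α, g α * f α σ) ^ 2) g ∂(gP ι))
        - ∫ g, (A μ f γ (fun σ => (1 / N) * ∑ α, g α * f α σ) g) ^ 2 ∂(gP ι)
      = (1 / (N * γ ^ 2)) * ∑ α : ι, ∑ α' : ι,
            ∫ g, iteratedFDeriv ℝ 4 (psi μ f γ N) g
              (fun m : Fin 4 => Pi.single (if (m : ℕ) < 2 then α else α') 1) ∂(gP ι)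
          + (1 / N ^ 2) * ∑ α : ι,
              ∫ g, (A μ f γ (fun σ => f α σ ^ 2) g - (A μ f γ (f α) g) ^ 2) ∂(gP ι) := by
  have A1 : ∀ g : ι → ℝ, A μ f γ (fun σ => (1 / N) * ∑ α, g α * f α σ) g
      = (1 / N) * ∑ α, g α * A μ f γ (f α) g := by
    intro g
    simp only [A, U, Finset.mul_sum, Finset.sum_div]
    rw [Finset.sum_comm]
    refine Finset.sum_congr rfl fun _ _ => Finset.sum_congr rfl fun _ _ => ?_
    ring
  have A2 : ∀ g : ι → ℝ, A μ f γ (fun σ => ((1 / N) * ∑ α, g α * f α σ) ^ 2) g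
      = ∑ α, ∑ β, (1 / N ^ 2) * (g α * g β * A μ f γ (fun σ => f α σ * f β σ) g) := by
    intro g
    simp only [sq_sum]
    simp only [A, U, Finset.mul_sum, Finset.sum_div]
    rw [Finset.sum_comm]
    refine Finset.sum_congr rfl fun _ _ => ?_
    rw [Finset.sum_comm]
    refine Finset.sum_congr rfl fun _ _ => Finset.sum_congr rfl fun _ _ => ?_
    ring
  have A3 : ∀ g : ι → ℝ, (A μ f γ (fun σ => (1 / N) * ∑ α, g α * f α σ) g) ^ 2
      = ∑ α, ∑ β, (1 / N ^ 2) * (g α * g β * (A μ f γ (f α) g * A μ f γ (f β) g)) := by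
    intro g
    rw [A1, sq_sum]
    refine Finset.sum_congr rfl fun _ _ => Finset.sum_congr rfl fun _ _ => ?_
    ring
  have I1 : ∀ α β : ι, Integrable (fun g : ι → ℝ =>
      (1 / N ^ 2) * (g α * g β * A μ f γ (fun σ => f α σ * f β σ) g)) (gP ι) := fun α β =>
    ((A_good f γ hμ0 hμ1 _).int_mul (int_coord2 α β)).const_mul _
  have I2 : ∀ α β : ι, Integrable (fun g : ι → ℝ =>
      (1 / N ^ 2) * (g α * g β * (A μ f γ (f α) g * A μ f γ (f β) g))) (gP ι) := fun α β =>
    (((GPoly.mul (.avg (f α)) (.avg (f β))).good f γ hμ0 hμ1).int_mul (int_coord2 α β)).const_mul _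
  simp_rw [A2, A3, d4_psi f γ hμ0 hμ1]
  rw [integral_finsetSum _ fun α _ => integrable_finsetSum _ fun β _ => I1 α β,
    integral_finsetSum _ fun α _ => integrable_finsetSum _ fun β _ => I2 α β,
    ← Finset.sum_sub_distrib, Finset.mul_sum, Finset.mul_sum, ← Finset.sum_add_distrib]
  refine Finset.sum_congr rfl fun α _ => ?_
  rw [integral_finsetSum _ fun β _ => I1 α β, integral_finsetSum _ fun β _ => I2 α β,
    ← Finset.sum_sub_distrib, Finset.mul_sum]
  have key : ∀ β : ι, (∫ g, (1 / N ^ 2) * (g α * g β * A μ f γ (fun σ => f α σ * f β σ) g) ∂(gP ι))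
      - ∫ g, (1 / N ^ 2) * (g α * g β * (A μ f γ (f α) g * A μ f γ (f β) g)) ∂(gP ι)
      = 1 / (N * γ ^ 2) * (∫ g, (γ ^ 2 / N) * d β (d α (V μ f γ α β)) g ∂(gP ι))
        + (if α = β then (1 / N ^ 2) * ∫ g, V μ f γ α β g ∂(gP ι) else 0) := by
    intro β
    have hv := V_poly (μ := μ) f γ α β
    have hv1 := hv.d f γ hμ0 hμ1 α
    have hv2 := hv1.d f γ hμ0 hμ1 β
    have st := stein_two α β (hv.good f γ hμ0 hμ1) (hv1.good f γ hμ0 hμ1) (hv2.good f γ hμ0 hμ1)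
    rw [← integral_sub (I1 α β) (I2 α β)]
    have : ∀ g : ι → ℝ, (1 / N ^ 2) * (g α * g β * A μ f γ (fun σ => f α σ * f β σ) g)
      - (1 / N ^ 2) * (g α * g β * (A μ f γ (f α) g * A μ f γ (f β) g))
      = (1 / N ^ 2) * (g α * g β * V μ f γ α β g) := by
      intro g; simp only [V]; ring
    simp_rw [this]
    rw [integral_const_mul, integral_const_mul, st]
    have hN' := hN.ne'
    split_ifs <;> field_simp <;> ring
  simp_rw [key]
  rw [Finset.sum_add_distrib, Finset.sum_ite_eq]
  simp only [Finset.mem_univ, if_true, V, pow_two]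

end Gibbs

end GibbsVar

theorem gibbs_variance_fourth_deriv_identity {S ι : Type*} [Fintype S] [Nonempty S]
    [Fintype ι] [DecidableEq ι]
    (μ : S → ℝ) (hμ0 : ∀ σ, 0 ≤ μ σ) (hμ1 : ∑ σ, μ σ = 1)
    (f : ι → S → ℝ) (hf : ∀ α σ, |f α σ| ≤ 1)
    (γ : ℝ) (hγ : γ ≠ 0) (N : ℝ) (hN : 0 < N) :
    let w : (ι → ℝ) → S → ℝ := fun g σ => μ σ * Real.exp (γ * ∑ α, g α * f α σ)
    let Z : (ι → ℝ) → ℝ := fun g => ∑ σ, w g σ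
    let avg : (ι → ℝ) → (S → ℝ) → ℝ := fun g h => (∑ σ, w g σ * h σ) / Z g
    let H : (ι → ℝ) → S → ℝ := fun g σ => (1 / N) * ∑ α, g α * f α σ
    let ψ : (ι → ℝ) → ℝ := fun g => (1 / N) * Real.log (Z g)
    let P : Measure (ι → ℝ) := Measure.pi fun _ : ι => gaussianReal 0 1
    (∫ g, avg g (fun σ => H g σ ^ 2) ∂P) - ∫ g, (avg g (H g)) ^ 2 ∂P
      = (1 / (N * γ ^ 2)) * ∑ α : ι, ∑ α' : ι,
            ∫ g, iteratedFDeriv ℝ 4 ψ g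
              (fun m : Fin 4 => Pi.single (if (m : ℕ) < 2 then α else α') 1) ∂P
          + (1 / N ^ 2) * ∑ α : ι,
              ∫ g, (avg g (fun σ => f α σ ^ 2) - (avg g (f α)) ^ 2) ∂P := by
  intro w Z avg H ψ P
  exact GibbsVar.main f γ hμ0 hμ1 hγ N hN
end
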